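/- Let n ≥ 4, let i ∈ {1,…,n}, and let x and y be adjacent vertices of the godan graph EA_n both lying in the cluster EA_n^{n:i}. Then the out neighbours x' = x∘(12)(3n) and y' = y∘(12)(3n) belong to a same cluster EA_n^{n:j} (i.e., x'(n) = y'(n)) if and only if y = x∘(12); moreover, in that case y' = x'∘(12). -/

import Mathlib

namespace Godan

/-- The transposition (12), using 0-based indices 0,1 for symbols 1,2. -/
def perm12 (n : ℕ) (hn : 3 ≤ n) : Equiv.Perm (Fin n) :=
  Equiv.swap ⟨0, by omega⟩ ⟨1, by omega⟩

/-- The 3-cycle (123): symbol 1 ↦ 2 ↦ 3 ↦ 1, i.e. index 0 ↦ 1 ↦ 2 ↦ 0. -/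
def perm123 (n : ℕ) (hn : 3 ≤ n) : Equiv.Perm (Fin n) :=
  Equiv.swap ⟨0, by omega⟩ ⟨2, by omega⟩ * Equiv.swap ⟨0, by omega⟩ ⟨1, by omega⟩

/-- The 3-cycle (132): symbol 1 ↦ 3 ↦ 2 ↦ 1, i.e. index 0 ↦ 2 ↦ 1 ↦ 0. -/
def perm132 (n : ℕ) (hn : 3 ≤ n) : Equiv.Perm (Fin n) :=
  Equiv.swap ⟨0, by omega⟩ ⟨1, by omega⟩ * Equiv.swap ⟨0, by omega⟩ ⟨2, by omega⟩

/-- Ω* = {(12), (123), (132)} ∪ {(12)(3i) : 4 ≤ i ≤ n}; symbol i has index i - 1,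
so the transposition (3i) is `Equiv.swap ⟨2,_⟩ k` with 3 ≤ k = i - 1 ≤ n - 1. -/
def OmegaStar (n : ℕ) (hn : 3 ≤ n) : Set (Equiv.Perm (Fin n)) :=
  {perm12 n hn, perm123 n hn, perm132 n hn} ∪
    {s | ∃ k : Fin n, 3 ≤ (k : ℕ) ∧ s = perm12 n hn * Equiv.swap ⟨2, by omega⟩ k}

/-- The godan graph EA_n: vertices are the permutations of {1,…,n}, and u,v are
adjacent iff u = v ∘ s for some s ∈ Ω* (note `(v * s) i = v (s i)` in Mathlib).
Since Ω* is closed under inverses, `fromRel` yields exactly this adjacency. -/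
def godanGraph (n : ℕ) (hn : 3 ≤ n) : SimpleGraph (Equiv.Perm (Fin n)) :=
  SimpleGraph.fromRel (fun u v => ∃ s ∈ OmegaStar n hn, u = v * s)

/-- The position of the n-th (last) symbol, as an index of `Fin n`. -/
def lastPos (n : ℕ) (hn : 3 ≤ n) : Fin n := ⟨n - 1, by omega⟩

/-- The permutation (12)(3n), giving the out neighbour x' = x ∘ (12)(3n). -/
def outPerm (n : ℕ) (hn : 4 ≤ n) : Equiv.Perm (Fin n) :=
  perm12 n (by omega) * Equiv.swap ⟨2, by omega⟩ ⟨n - 1, by omega⟩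

theorem perm12_mul_self (n : ℕ) (hn : 3 ≤ n) : perm12 n hn * perm12 n hn = 1 :=
  Equiv.swap_mul_self _ _

theorem perm12_apply_two (n : ℕ) (hn : 3 ≤ n) :
    perm12 n hn ⟨2, by omega⟩ = ⟨2, by omega⟩ :=
  Equiv.swap_apply_of_ne_of_ne (by simp) (by simp)

theorem perm12_apply_of_three_le (n : ℕ) (hn : 3 ≤ n) (k : Fin n) (hk : 3 ≤ (k : ℕ)) :
    perm12 n hn k = k :=
  Equiv.swap_apply_of_ne_of_ne (by rw [Ne, Fin.ext_iff]; simp; omega)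
    (by rw [Ne, Fin.ext_iff]; simp; omega)

/-- The only generator of the godan graph that fixes symbol 3 is (12). -/
theorem eq_perm12_of_apply_two (n : ℕ) (hn : 3 ≤ n) {s : Equiv.Perm (Fin n)}
    (hs : s ∈ OmegaStar n hn) (h : s ⟨2, by omega⟩ = ⟨2, by omega⟩) :
    s = perm12 n hn := by
  rcases hs with (rfl | rfl | rfl) | ⟨k, hk, rfl⟩
  · rfl
  · simp [perm123, Equiv.swap_apply_def] at h
  · simp [perm132] at h
  · rw [Equiv.Perm.mul_apply, Equiv.swap_apply_left, perm12_apply_of_three_le n hn k hk] at h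
    subst h
    simp at hk

theorem outPerm_apply_lastPos (n : ℕ) (hn : 4 ≤ n) :
    outPerm n hn (lastPos n (by omega)) = ⟨2, by omega⟩ := by
  rw [outPerm, lastPos, Equiv.Perm.mul_apply, Equiv.swap_apply_right, perm12_apply_two]

theorem commute_perm12_outPerm (n : ℕ) (hn : 4 ≤ n) :
    Commute (perm12 n (by omega)) (outPerm n hn) := by
  refine (Commute.refl _).mul_right ?_
  rw [commute_iff_eq, Equiv.mul_swap_eq_swap_mul, perm12_apply_two,
    perm12_apply_of_three_le _ _ _ (by simp; omega)]

/-- Let n ≥ 4 and let x, y be adjacent vertices of EA_n lying in the same cluster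
EA_n^{n:i} (symbols 0-based). Then the out neighbours x' = x∘(12)(3n) and
y' = y∘(12)(3n) lie in a same cluster iff y = x∘(12); moreover in that case
y' = x'∘(12). -/
theorem out_neighbours_same_cluster (n : ℕ) (hn : 4 ≤ n) (i : Fin n)
    (x y : Equiv.Perm (Fin n)) (hadj : (godanGraph n (by omega)).Adj x y)
    (hx : x (lastPos n (by omega)) = i) (hy : y (lastPos n (by omega)) = i) :
    ((y * outPerm n hn) (lastPos n (by omega)) =
        (x * outPerm n hn) (lastPos n (by omega)) ↔
      y = x * perm12 n (by omega)) ∧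
    (y = x * perm12 n (by omega) →
      y * outPerm n hn = x * outPerm n hn * perm12 n (by omega)) := by
  refine ⟨?_, ?_⟩
  · rw [Equiv.Perm.mul_apply, Equiv.Perm.mul_apply, outPerm_apply_lastPos]
    constructor
    · intro h
      rw [godanGraph, SimpleGraph.fromRel_adj] at hadj
      obtain ⟨-, ⟨s, hs, rfl⟩ | ⟨s, hs, rfl⟩⟩ := hadj
      · rw [eq_perm12_of_apply_two n _ hs (y.injective h.symm), mul_assoc, perm12_mul_self,
          mul_one]
      · rw [eq_perm12_of_apply_two n _ hs (x.injective h)]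
    · intro h
      rw [h, Equiv.Perm.mul_apply, perm12_apply_two]
  · intro h
    rw [h, mul_assoc, mul_assoc, (commute_perm12_outPerm n hn).eq]

end Godan
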